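/- Let α ∈ {14, 16, 18, 20, 22, 24}, β = 6, a, b > 0, and f(r) = a r^{-α} - b r^{-β}. Set V_{A₂} = (a α ζ_{A₂}(α) / (b β ζ_{A₂}(β)))^{2/(α-β)}. Then for every two-dimensional lattice L, E_f[L] ≥ E_f[√(V_{A₂})·A₂], with equality if and only if L = O·(√(V_{A₂})·A₂) for some orthogonal transformation O of ℝ²; that is, the triangular lattice of co-volume V_{A₂} is the unique global minimizer of E_f among all two-dimensional lattices, up to rotation. -/

import Mathlib

open scoped Pointwise

noncomputable section

/-- A point of the Euclidean plane with coordinates `a`, `b`. -/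
def vec2 (a b : ℝ) : EuclideanSpace ℝ (Fin 2) := (WithLp.equiv 2 (Fin 2 → ℝ)).symm ![a, b]

/-- The lattice (as a set of points) generated by `u` and `v`. -/
def latticeSet (u v : EuclideanSpace ℝ (Fin 2)) : Set (EuclideanSpace ℝ (Fin 2)) :=
  {p | ∃ m n : ℤ, p = (m : ℝ) • u + (n : ℝ) • v}

/-- The determinant of the pair of plane vectors `(u, v)`. -/
def det2 (u v : EuclideanSpace ℝ (Fin 2)) : ℝ := u 0 * v 1 - u 1 * v 0

/-- `L` is a two-dimensional lattice, i.e. `L = ℤu ⊕ ℤv` for a basis `(u,v)` of ℝ². -/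
def IsLattice2 (L : Set (EuclideanSpace ℝ (Fin 2))) : Prop :=
  ∃ u v : EuclideanSpace ℝ (Fin 2), det2 u v ≠ 0 ∧ L = latticeSet u v

/-- `L` is a two-dimensional lattice of co-volume `V = |det(u,v)|`. -/
def IsLattice2OfCovol (L : Set (EuclideanSpace ℝ (Fin 2))) (V : ℝ) : Prop :=
  ∃ u v : EuclideanSpace ℝ (Fin 2), det2 u v ≠ 0 ∧ |det2 u v| = V ∧ L = latticeSet u v

/-- The Epstein zeta function of a set of points: `ζ_L(s) = Σ'_{p ∈ L, p ≠ 0} |p|^{-s}`. -/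
def epsteinZeta (L : Set (EuclideanSpace ℝ (Fin 2))) (s : ℝ) : ℝ :=
  ∑' p : ↥(L \ {0}), ‖(p : EuclideanSpace ℝ (Fin 2))‖ ^ (-s)

/-- The Lennard-Jones type energy `E_f[L] = Σ'_{p ∈ L, p ≠ 0} (a|p|^{-α} - b|p|^{-β})`. -/
def LJenergy (a b α β : ℝ) (L : Set (EuclideanSpace ℝ (Fin 2))) : ℝ :=
  ∑' p : ↥(L \ {0}),
    (a * ‖(p : EuclideanSpace ℝ (Fin 2))‖ ^ (-α) - b * ‖(p : EuclideanSpace ℝ (Fin 2))‖ ^ (-β))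

/-- The triangular lattice `A₂ = √(2/√3)·[ℤ(1,0) ⊕ ℤ(1/2,√3/2)]`, of co-volume 1. -/
def triangularLattice : Set (EuclideanSpace ℝ (Fin 2)) :=
  latticeSet (Real.sqrt (2 / Real.sqrt 3) • vec2 1 0)
    (Real.sqrt (2 / Real.sqrt 3) • vec2 (1 / 2) (Real.sqrt 3 / 2))

/-- The square lattice `ℤ² = ℤ(1,0) ⊕ ℤ(0,1)`. -/
def squareLattice : Set (EuclideanSpace ℝ (Fin 2)) := latticeSet (vec2 1 0) (vec2 0 1)

/-- `L` is the image of `L'` under an orthogonal transformation of ℝ². -/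
def IsRotationOf (L L' : Set (EuclideanSpace ℝ (Fin 2))) : Prop :=
  ∃ O : EuclideanSpace ℝ (Fin 2) ≃ₗᵢ[ℝ] EuclideanSpace ℝ (Fin 2), L = O '' L'

/-- The unit co-volume lattice parametrized by `(x, y)` in the half-fundamental domain:
`ℤu ⊕ ℤv` with `u = (1/√y, 0)` and `v = (x/√y, √y)`. -/
def latticeXY (x y : ℝ) : Set (EuclideanSpace ℝ (Fin 2)) :=
  latticeSet (vec2 (1 / Real.sqrt y) 0) (vec2 (x / Real.sqrt y) (Real.sqrt y))

/-- The Riemann zeta function `ζ(s) = Σ_{m ≥ 1} m^{-s}` (real variable version). -/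
def riemannZetaReal (s : ℝ) : ℝ := ∑' n : ℕ+, (n : ℝ) ^ (-s)

end

/-- The squared norm of `i • e + j • f` when `‖e‖² = A`, `‖f‖² = B` and `‖e - f‖² = C`. -/
noncomputable def sideForm (A B C i j : ℝ) : ℝ := (i + j) * (i * A + j * B) - i * j * C

/-- `A`, `B`, `C` are the squared side lengths of a nondegenerate triangle without obtuse angle. -/
structure NonObtuse (A B C : ℝ) : Prop where
  posA : 0 < A
  posB : 0 < B
  posC : 0 < C
  leA : A ≤ B + C
  leB : B ≤ C + A
  leC : C ≤ A + B

theorem NonObtuse.rotate {A B C : ℝ} (h : NonObtuse A B C) : NonObtuse B C A :=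
  ⟨h.posB, h.posC, h.posA, h.leB, h.leC, h.leA⟩

theorem NonObtuse.one : NonObtuse 1 1 1 := by constructor <;> norm_num

theorem NonObtuse.smul {A B C c : ℝ} (h : NonObtuse A B C) (hc : 0 < c) :
    NonObtuse (c * A) (c * B) (c * C) := by
  obtain ⟨h1, h2, h3, h4, h5, h6⟩ := h
  constructor <;> first | positivity | nlinarith

theorem NonObtuse.le_sideForm {A B C : ℝ} (h : NonObtuse A B C) {i j : ℝ} (hi : 0 ≤ i)
    (hj : 0 ≤ j) : i ^ 2 * A + j ^ 2 * B ≤ sideForm A B C i j := by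
  have := mul_nonneg (mul_nonneg hi hj) (sub_nonneg.2 h.leC)
  unfold sideForm
  nlinarith

theorem NonObtuse.sideForm_pos {A B C : ℝ} (h : NonObtuse A B C) {i j : ℝ} (hi : 0 < i)
    (hj : 0 ≤ j) : 0 < sideForm A B C i j := by
  have := h.le_sideForm hi.le hj
  have := h.posA
  have := h.posB
  have : 0 < i ^ 2 * A + j ^ 2 * B := by positivity
  linarith

/-- The contribution to `∑ Q ^ (-k)` of a triple of vectors, one in the interior of each of
three cones. -/
noncomputable def coneTerm (k : ℕ) (A B C : ℝ) (x : ℕ × ℕ) : ℝ :=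
  (sideForm A B C (x.1 + 1) (x.2 + 1) ^ k)⁻¹ + (sideForm B C A (x.1 + 1) (x.2 + 1) ^ k)⁻¹ +
    (sideForm C A B (x.1 + 1) (x.2 + 1) ^ k)⁻¹

/-- The total contribution of the open cones. -/
noncomputable def coneSum (k : ℕ) (A B C : ℝ) : ℝ := ∑' x, coneTerm k A B C x

/-- The sum `ζ(2 * k)`, the contribution of a ray. -/
noncomputable def raySum (k : ℕ) : ℝ := ∑' n : ℕ, (((n : ℝ) + 1) ^ (2 * k))⁻¹

theorem summable_inv_succ_pow {k : ℕ} (hk : 2 ≤ k) :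
    Summable fun n : ℕ => (((n : ℝ) + 1) ^ k)⁻¹ := by
  have := (summable_nat_add_iff 1).2 (Real.summable_nat_pow_inv.2 (show 1 < k by omega))
  simpa using this

theorem summable_inv_mul_succ_pow {k : ℕ} (hk : 2 ≤ k) :
    Summable fun x : ℕ × ℕ => ((((x.1 : ℝ) + 1) * ((x.2 : ℝ) + 1)) ^ k)⁻¹ := by
  have h := (summable_inv_succ_pow hk).mul_of_nonneg (summable_inv_succ_pow hk)
    (fun n => by positivity) (fun n => by positivity)
  refine h.congr fun x => ?_
  rw [mul_pow, mul_inv]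

theorem tsum_inv_succ_cube_le : ∑' n : ℕ, (((n : ℝ) + 1) ^ 3)⁻¹ ≤ 1.2038 := by
  have key : ∀ n : ℕ, ∑ i ∈ Finset.range (n + 3), (((i : ℝ) + 1) ^ 3)⁻¹ ≤
      1.2038 - 1 / (2 * ((n : ℝ) + 3) * (n + 4)) := by
    intro n
    induction n with
    | zero => norm_num [Finset.sum_range_succ]
    | succ n ih =>
      rw [show n + 1 + 3 = (n + 3) + 1 by ring, Finset.sum_range_succ]
      have h : (((n + 3 : ℕ) : ℝ) + 1) ^ 3 ≥ (n + 3) * (n + 4) * (n + 5) := by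
        push_cast
        nlinarith [(Nat.cast_nonneg n : (0 : ℝ) ≤ n)]
      have h2 := inv_anti₀ (by positivity) h
      have h3 : ((n + 3 : ℝ) * (n + 4) * (n + 5))⁻¹ =
          1 / (2 * ((n : ℝ) + 3) * (n + 4)) - 1 / (2 * ((n : ℝ) + 4) * (n + 5)) := by
        field_simp
        ring
      have h4 : (2 * (((n + 1 : ℕ) : ℝ) + 3) * (((n + 1 : ℕ) : ℝ) + 4)) =
          2 * ((n : ℝ) + 4) * (n + 5) := by push_cast; ring
      rw [h4]
      linarith
  refine Real.tsum_le_of_sum_range_le (fun n => by positivity) fun n => ?_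
  have h1 : ∑ i ∈ Finset.range n, (((i : ℝ) + 1) ^ 3)⁻¹ ≤
      ∑ i ∈ Finset.range (n + 3), (((i : ℝ) + 1) ^ 3)⁻¹ :=
    Finset.sum_le_sum_of_subset_of_nonneg (Finset.range_mono (by omega))
      fun i _ _ => by positivity
  have h2 : 0 ≤ 1 / (2 * ((n : ℝ) + 3) * (n + 4)) := by positivity
  linarith [key n]

theorem tsum_inv_mul_succ_cube_le :
    ∑' x : ℕ × ℕ, ((((x.1 : ℝ) + 1) * ((x.2 : ℝ) + 1)) ^ 3)⁻¹ ≤ 1.4492 := by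
  have hs := summable_inv_succ_pow (k := 3) (by norm_num)
  have h := hs.tsum_mul_tsum hs
    (hs.mul_of_nonneg hs (fun n => by positivity) (fun n => by positivity))
  have h' : ∑' x : ℕ × ℕ, ((((x.1 : ℝ) + 1) * ((x.2 : ℝ) + 1)) ^ 3)⁻¹ =
      (∑' n : ℕ, (((n : ℝ) + 1) ^ 3)⁻¹) * ∑' n : ℕ, (((n : ℝ) + 1) ^ 3)⁻¹ := by
    rw [h]
    simp only [mul_pow, mul_inv]
  rw [h']
  have h0 : 0 ≤ ∑' n : ℕ, (((n : ℝ) + 1) ^ 3)⁻¹ := tsum_nonneg fun n => by positivity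
  nlinarith [tsum_inv_succ_cube_le]

theorem one_le_raySum {k : ℕ} (hk : 1 ≤ k) : 1 ≤ raySum k := by
  have h := (summable_inv_succ_pow (k := 2 * k) (by omega)).le_tsum 0
    (fun n _ => by positivity)
  simpa [raySum] using h

theorem NonObtuse.inv_sideForm_pow_le {A B C : ℝ} (h : NonObtuse A B C) (k : ℕ) {i j : ℝ}
    (hi : 0 < i) (hj : 0 < j) :
    (sideForm A B C i j ^ k)⁻¹ ≤ ((2 * (√A * √B)) ^ k)⁻¹ * ((i * j) ^ k)⁻¹ := by
  have hA := h.posA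
  have hB := h.posB
  rw [← mul_inv, ← mul_pow]
  refine inv_anti₀ (by positivity) (pow_le_pow_left₀ (by positivity) ?_ k)
  have h1 := h.le_sideForm hi.le hj.le
  nlinarith [sq_nonneg (i * √A - j * √B), Real.sq_sqrt hA.le, Real.sq_sqrt hB.le]

theorem coneTerm_nonneg {A B C : ℝ} (h : NonObtuse A B C) (k : ℕ) (x : ℕ × ℕ) :
    0 ≤ coneTerm k A B C x := by
  have h1 := h.sideForm_pos (i := x.1 + 1) (j := x.2 + 1) (by positivity) (by positivity)
  have h2 := h.rotate.sideForm_pos (i := x.1 + 1) (j := x.2 + 1) (by positivity) (by positivity)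
  have h3 := h.rotate.rotate.sideForm_pos (i := x.1 + 1) (j := x.2 + 1) (by positivity)
    (by positivity)
  unfold coneTerm
  positivity

theorem coneTerm_le {A B C : ℝ} (h : NonObtuse A B C) (k : ℕ) (x : ℕ × ℕ) :
    coneTerm k A B C x ≤ (((2 * (√A * √B)) ^ k)⁻¹ + ((2 * (√B * √C)) ^ k)⁻¹ +
      ((2 * (√C * √A)) ^ k)⁻¹) * ((((x.1 : ℝ) + 1) * ((x.2 : ℝ) + 1)) ^ k)⁻¹ := by
  have h1 := h.inv_sideForm_pow_le k (i := x.1 + 1) (j := x.2 + 1) (by positivity) (by positivity)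
  have h2 := h.rotate.inv_sideForm_pow_le k (i := x.1 + 1) (j := x.2 + 1) (by positivity)
    (by positivity)
  have h3 := h.rotate.rotate.inv_sideForm_pow_le k (i := x.1 + 1) (j := x.2 + 1) (by positivity)
    (by positivity)
  unfold coneTerm
  linarith

theorem summable_coneTerm {A B C : ℝ} (h : NonObtuse A B C) {k : ℕ} (hk : 2 ≤ k) :
    Summable (coneTerm k A B C) :=
  Summable.of_nonneg_of_le (coneTerm_nonneg h k) (coneTerm_le h k)
    ((summable_inv_mul_succ_pow hk).mul_left _)

theorem coneTerm_one (k : ℕ) (x : ℕ × ℕ) :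
    coneTerm k 1 1 1 x = 3 * (sideForm 1 1 1 (x.1 + 1) (x.2 + 1) ^ k)⁻¹ := by
  unfold coneTerm
  ring

theorem three_mul_le_sideForm_one (i j : ℝ) : 3 * (i * j) ≤ sideForm 1 1 1 i j := by
  unfold sideForm
  nlinarith [sq_nonneg (i - j)]

theorem three_le_sideForm_one (x : ℕ × ℕ) :
    3 ≤ sideForm 1 1 1 ((x.1 : ℝ) + 1) ((x.2 : ℝ) + 1) := by
  refine le_trans ?_ (three_mul_le_sideForm_one _ _)
  have h1 : (0 : ℝ) ≤ x.1 := Nat.cast_nonneg _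
  have h2 : (0 : ℝ) ≤ x.2 := Nat.cast_nonneg _
  nlinarith [mul_nonneg h1 h2]

theorem coneSum_one_three_le : coneSum 3 1 1 1 ≤ 0.1611 := by
  have h : coneSum 3 1 1 1 ≤
      ∑' x : ℕ × ℕ, 1 / 9 * ((((x.1 : ℝ) + 1) * ((x.2 : ℝ) + 1)) ^ 3)⁻¹ := by
    refine (summable_coneTerm NonObtuse.one (by norm_num)).tsum_le_tsum (fun x => ?_)
      ((summable_inv_mul_succ_pow (by norm_num)).mul_left _)
    rw [coneTerm_one]
    have := inv_anti₀ (by positivity) (pow_le_pow_left₀ (by positivity)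
      (three_mul_le_sideForm_one (x.1 + 1) (x.2 + 1)) 3)
    rw [mul_pow, mul_inv] at this
    linarith
  rw [tsum_mul_left] at h
  linarith [tsum_inv_mul_succ_cube_le]

theorem coneSum_one_three_ge : 1 / 9 ≤ coneSum 3 1 1 1 := by
  have h := (summable_coneTerm NonObtuse.one (k := 3) (by norm_num)).le_tsum (0, 0)
    (fun x _ => coneTerm_nonneg NonObtuse.one 3 x)
  refine le_trans ?_ h
  rw [coneTerm_one]
  norm_num [sideForm]

theorem coneSum_one_le {k : ℕ} (hk : 7 ≤ k) : coneSum k 1 1 1 ≤ 0.002 := by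
  have h : coneSum k 1 1 1 ≤ ∑' x, 1 / 81 * coneTerm 3 1 1 1 x := by
    refine (summable_coneTerm NonObtuse.one (by omega)).tsum_le_tsum (fun x => ?_)
      ((summable_coneTerm NonObtuse.one (by norm_num)).mul_left _)
    rw [coneTerm_one, coneTerm_one]
    have h3 := three_le_sideForm_one x
    set N := sideForm 1 1 1 ((x.1 : ℝ) + 1) ((x.2 : ℝ) + 1)
    have h1 : 81 * N ^ 3 ≤ N ^ k := by
      calc 81 * N ^ 3 ≤ N ^ 4 * N ^ 3 := by
            have := pow_le_pow_left₀ (by norm_num) h3 4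
            gcongr
            linarith
        _ = N ^ 7 := by ring
        _ ≤ N ^ k := pow_le_pow_right₀ (by linarith) hk
    have := inv_anti₀ (by positivity) h1
    rw [mul_inv] at this
    linarith
  rw [tsum_mul_left] at h
  have := coneSum_one_three_le
  unfold coneSum at *
  linarith

theorem coneSum_nonneg {A B C : ℝ} (h : NonObtuse A B C) (k : ℕ) : 0 ≤ coneSum k A B C :=
  tsum_nonneg (coneTerm_nonneg h k)

theorem bounds_of_inv_cube {A : ℝ} (hA : 0 < A) (hx : ((A ^ 3)⁻¹ - 1) ^ 2 ≤ 0.5334) :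
    0.8328 ≤ A ∧ A ≤ 1.5481 := by
  have h3 : 0 < A ^ 3 := by positivity
  constructor
  · by_contra! hl
    have h1 : A ^ 3 < 0.8328 ^ 3 := pow_lt_pow_left₀ hl hA.le (by norm_num)
    have h2 := inv_strictAnti₀ h3 h1
    norm_num at h2
    nlinarith
  · by_contra! hl
    have h1 : 1.5481 ^ 3 < A ^ 3 := pow_lt_pow_left₀ hl (by norm_num) (by norm_num)
    have h2 := inv_strictAnti₀ (by norm_num) h1
    norm_num at h2
    nlinarith

theorem tangent_le {A : ℝ} (hA : 0 < A) : 1 - ((A ^ 3)⁻¹ - 1) / 3 ≤ A := by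
  have h : A - (1 - ((A ^ 3)⁻¹ - 1) / 3) = (A - 1) ^ 2 * (3 * A ^ 2 + 2 * A + 1) / (3 * A ^ 3) := by
    field_simp
    ring
  have : 0 ≤ (A - 1) ^ 2 * (3 * A ^ 2 + 2 * A + 1) / (3 * A ^ 3) := by positivity
  linarith

theorem sub_one_sq_le {A : ℝ} (hA : 0 < A) (h : A ≤ 1.5481) :
    (A - 1) ^ 2 ≤ 0.5634 * ((A ^ 3)⁻¹ - 1) ^ 2 := by
  have h1 : A ^ 3 ≤ 0.7505 * (1 + A + A ^ 2) := by
    nlinarith [mul_nonneg (mul_nonneg hA.le hA.le) (sub_nonneg.2 h),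
      mul_nonneg hA.le (sub_nonneg.2 h)]
  have h2 : (A ^ 3) ^ 2 ≤ 0.5634 * (1 + A + A ^ 2) ^ 2 := by
    have := pow_le_pow_left₀ (by positivity) h1 2
    nlinarith [sq_nonneg (1 + A + A ^ 2)]
  have h3 : 0.5634 * ((A ^ 3)⁻¹ - 1) ^ 2 - (A - 1) ^ 2 =
      (A - 1) ^ 2 * (0.5634 * (1 + A + A ^ 2) ^ 2 - (A ^ 3) ^ 2) / (A ^ 3) ^ 2 := by
    field_simp
    ring
  have : 0 ≤ (A - 1) ^ 2 * (0.5634 * (1 + A + A ^ 2) ^ 2 - (A ^ 3) ^ 2) / (A ^ 3) ^ 2 :=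
    div_nonneg (mul_nonneg (sq_nonneg _) (by linarith)) (by positivity)
  linarith

theorem le_quadratic {A : ℝ} (hA : 0 < A) (h : A ≤ 1.5481) :
    A ≤ 1 - ((A ^ 3)⁻¹ - 1) / 3 + 0.6 * ((A ^ 3)⁻¹ - 1) ^ 2 := by
  have h3 : 1 - ((A ^ 3)⁻¹ - 1) / 3 + 0.6 * ((A ^ 3)⁻¹ - 1) ^ 2 - A =
      (A - 1) ^ 2 * (0.6 * (1 + A + A ^ 2) ^ 2 - A ^ 3 * (3 * A ^ 2 + 2 * A + 1) / 3) /
        (A ^ 3) ^ 2 := by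
    field_simp
    ring
  have h4 : A ^ 3 * (3 * A ^ 2 + 2 * A + 1) / 3 ≤ 0.6 * (1 + A + A ^ 2) ^ 2 := by
    have hA2 := mul_nonneg hA.le hA.le
    have hA3 := mul_nonneg hA.le hA2
    have hA4 := mul_nonneg hA.le hA3
    nlinarith [mul_nonneg hA4 (sub_nonneg.2 h), mul_nonneg hA3 (sub_nonneg.2 h),
      mul_nonneg hA2 (sub_nonneg.2 h), mul_nonneg hA.le (sub_nonneg.2 h)]
  have : 0 ≤ (A - 1) ^ 2 * (0.6 * (1 + A + A ^ 2) ^ 2 - A ^ 3 * (3 * A ^ 2 + 2 * A + 1) / 3) /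
      (A ^ 3) ^ 2 := div_nonneg (mul_nonneg (sq_nonneg _) (by linarith)) (by positivity)
  linarith

theorem inv_cube_le_quadratic {d : ℝ} (hd : 0.594 ≤ d) :
    (d ^ 3)⁻¹ ≤ 1 - 3 * (d - 1) + 15.6 * (d - 1) ^ 2 := by
  have hd0 : 0 < d := by linarith
  have h : 1 - 3 * (d - 1) + 15.6 * (d - 1) ^ 2 - (d ^ 3)⁻¹ =
      (d - 1) ^ 2 * (15.6 * d ^ 3 - 3 * d ^ 2 - 2 * d - 1) / d ^ 3 := by
    field_simp
    ring
  have h2 : 0 ≤ 15.6 * d ^ 3 - 3 * d ^ 2 - 2 * d - 1 := by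
    obtain ⟨e, rfl⟩ : ∃ e, d = 0.594 + e := ⟨d - 0.594, by ring⟩
    have he : 0 ≤ e := by linarith
    have := pow_nonneg he 3
    nlinarith [sq_nonneg e]
  have : 0 ≤ (d - 1) ^ 2 * (15.6 * d ^ 3 - 3 * d ^ 2 - 2 * d - 1) / d ^ 3 := by positivity
  linarith

theorem tangent_le_inv_pow {d : ℝ} (hd : 0 < d) (k : ℕ) :
    1 - (k : ℝ) * (d - 1) ≤ (d ^ k)⁻¹ := by
  have h : 1 - d ≤ d⁻¹ - 1 := by
    have : d⁻¹ - 1 - (1 - d) = (d - 1) ^ 2 / d := by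
      field_simp
      ring
    have : 0 ≤ (d - 1) ^ 2 / d := by positivity
    linarith
  have h1 := one_add_mul_le_pow (show -2 ≤ d⁻¹ - 1 by
    have : 0 < d⁻¹ := by positivity
    linarith) k
  have h2 : (1 + (d⁻¹ - 1)) ^ k = (d ^ k)⁻¹ := by
    rw [← inv_pow]
    congr 1
    ring
  rw [h2] at h1
  have h3 := mul_le_mul_of_nonneg_left h (Nat.cast_nonneg (α := ℝ) k)
  linarith

/-- The squared deviation of the reciprocal cubes from `1`. -/
noncomputable def deviation (A B C : ℝ) : ℝ :=
  ((A ^ 3)⁻¹ - 1) ^ 2 + ((B ^ 3)⁻¹ - 1) ^ 2 + ((C ^ 3)⁻¹ - 1) ^ 2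

theorem sq_bounds_of_deviation {A B C : ℝ} (hs : (A ^ 3)⁻¹ + (B ^ 3)⁻¹ + (C ^ 3)⁻¹ = 3)
    (hV : deviation A B C ≤ 0.8) :
    ((A ^ 3)⁻¹ - 1) ^ 2 ≤ 0.5334 ∧ ((B ^ 3)⁻¹ - 1) ^ 2 ≤ 0.5334 ∧
      ((C ^ 3)⁻¹ - 1) ^ 2 ≤ 0.5334 := by
  unfold deviation at hV
  set x := (A ^ 3)⁻¹
  set y := (B ^ 3)⁻¹
  obtain hz : (C ^ 3)⁻¹ = 3 - x - y := by linarith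
  rw [hz] at hV ⊢
  refine ⟨?_, ?_, ?_⟩
  · nlinarith [sq_nonneg (y - 1 - (3 - x - y - 1))]
  · nlinarith [sq_nonneg (x - 1 - (3 - x - y - 1))]
  · nlinarith [sq_nonneg (x - y)]

theorem inv_sideForm_pow_eq {N : ℝ} (hN : N ≠ 0) (h : ℝ) (k : ℕ) :
    (h ^ k)⁻¹ = (N ^ k)⁻¹ * ((h / N) ^ k)⁻¹ := by
  rw [← mul_inv, ← mul_pow, mul_div_cancel₀ _ hN]

theorem coneTerm_eq (k : ℕ) (A B C : ℝ) (x : ℕ × ℕ) :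
    coneTerm k A B C x = (sideForm 1 1 1 (x.1 + 1) (x.2 + 1) ^ k)⁻¹ *
      (((sideForm A B C (x.1 + 1) (x.2 + 1) / sideForm 1 1 1 (x.1 + 1) (x.2 + 1)) ^ k)⁻¹ +
      ((sideForm B C A (x.1 + 1) (x.2 + 1) / sideForm 1 1 1 (x.1 + 1) (x.2 + 1)) ^ k)⁻¹ +
      ((sideForm C A B (x.1 + 1) (x.2 + 1) / sideForm 1 1 1 (x.1 + 1) (x.2 + 1)) ^ k)⁻¹) := by
  have hN : sideForm 1 1 1 ((x.1 : ℝ) + 1) ((x.2 : ℝ) + 1) ≠ 0 := by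
    linarith [three_le_sideForm_one x]
  unfold coneTerm
  rw [inv_sideForm_pow_eq hN (sideForm A B C _ _), inv_sideForm_pow_eq hN (sideForm B C A _ _),
    inv_sideForm_pow_eq hN (sideForm C A B _ _)]
  ring

theorem sideForm_div_sum {i j : ℝ} (hN : sideForm 1 1 1 i j ≠ 0) (A B C : ℝ) :
    sideForm A B C i j / sideForm 1 1 1 i j + sideForm B C A i j / sideForm 1 1 1 i j +
      sideForm C A B i j / sideForm 1 1 1 i j = A + B + C := by
  field_simp
  unfold sideForm
  ring

theorem sideForm_div_sq_sum {i j : ℝ} (hN : sideForm 1 1 1 i j ≠ 0) (A B C : ℝ) :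
    (sideForm A B C i j / sideForm 1 1 1 i j - 1) ^ 2 +
      (sideForm B C A i j / sideForm 1 1 1 i j - 1) ^ 2 +
      (sideForm C A B i j / sideForm 1 1 1 i j - 1) ^ 2 =
    (A - 1) ^ 2 + (B - 1) ^ 2 + (C - 1) ^ 2 := by
  field_simp
  unfold sideForm
  ring

theorem le_sideForm_div {A B C i j : ℝ} (hi : 0 < i) (hj : 0 < j) (hA : 0.8328 ≤ A)
    (hB : 0.8328 ≤ B) (hC : C ≤ 1.5481) : 0.594 ≤ sideForm A B C i j / sideForm 1 1 1 i j := by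
  have hij := mul_pos hi hj
  have h1 := three_mul_le_sideForm_one i j
  rw [le_div_iff₀ (by linarith)]
  have h2 := mul_nonneg (add_pos (pow_pos hi 2) hij).le (sub_nonneg.2 hA)
  have h3 := mul_nonneg (add_pos (pow_pos hj 2) hij).le (sub_nonneg.2 hB)
  have h4 := mul_nonneg hij.le (sub_nonneg.2 hC)
  unfold sideForm at *
  nlinarith

theorem coneSum_three_le {A B C : ℝ} (h : NonObtuse A B C)
    (hs : (A ^ 3)⁻¹ + (B ^ 3)⁻¹ + (C ^ 3)⁻¹ = 3) (hV : deviation A B C ≤ 0.8) :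
    coneSum 3 A B C ≤ (1 + 3 * deviation A B C) * coneSum 3 1 1 1 := by
  obtain ⟨hx, hy, hz⟩ := sq_bounds_of_deviation hs hV
  have hA := bounds_of_inv_cube h.posA hx
  have hB := bounds_of_inv_cube h.posB hy
  have hC := bounds_of_inv_cube h.posC hz
  have key : ∀ x, coneTerm 3 A B C x ≤ (1 + 3 * deviation A B C) * coneTerm 3 1 1 1 x := by
    intro x
    have hN3 := three_le_sideForm_one x
    have hN : sideForm 1 1 1 ((x.1 : ℝ) + 1) ((x.2 : ℝ) + 1) ≠ 0 := by linarith
    have hi : (0 : ℝ) < x.1 + 1 := by positivity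
    have hj : (0 : ℝ) < x.2 + 1 := by positivity
    rw [coneTerm_eq, coneTerm_one]
    have e1 := sideForm_div_sum hN A B C
    have e2 := sideForm_div_sq_sum hN A B C
    have d1 := inv_cube_le_quadratic (le_sideForm_div hi hj hA.1 hB.1 hC.2)
    have d2 := inv_cube_le_quadratic (le_sideForm_div hi hj hB.1 hC.1 hA.2)
    have d3 := inv_cube_le_quadratic (le_sideForm_div hi hj hC.1 hA.1 hB.2)
    have t1 := tangent_le h.posA
    have t2 := tangent_le h.posB
    have t3 := tangent_le h.posC
    have q1 := sub_one_sq_le h.posA hA.2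
    have q2 := sub_one_sq_le h.posB hB.2
    have q3 := sub_one_sq_le h.posC hC.2
    have hinv : 0 ≤ (sideForm 1 1 1 ((x.1 : ℝ) + 1) ((x.2 : ℝ) + 1) ^ 3)⁻¹ := by positivity
    rw [show ∀ u w : ℝ, (1 + 3 * u) * (3 * w) = w * (3 + 9 * u) by intros; ring]
    refine mul_le_mul_of_nonneg_left ?_ hinv
    unfold deviation
    nlinarith [sq_nonneg ((A ^ 3)⁻¹ - 1), sq_nonneg ((B ^ 3)⁻¹ - 1), sq_nonneg ((C ^ 3)⁻¹ - 1)]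
  unfold coneSum
  rw [← tsum_mul_left]
  exact (summable_coneTerm h (by norm_num)).tsum_le_tsum key
    ((summable_coneTerm NonObtuse.one (by norm_num)).mul_left _)

theorem coneSum_ge {A B C : ℝ} (h : NonObtuse A B C)
    (hs : (A ^ 3)⁻¹ + (B ^ 3)⁻¹ + (C ^ 3)⁻¹ = 3) (hV : deviation A B C ≤ 0.8) {k : ℕ}
    (hk : 2 ≤ k) :
    (1 - k * (0.2 * deviation A B C)) * coneSum k 1 1 1 ≤ coneSum k A B C := by
  obtain ⟨hx, hy, hz⟩ := sq_bounds_of_deviation hs hV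
  have hA := bounds_of_inv_cube h.posA hx
  have hB := bounds_of_inv_cube h.posB hy
  have hC := bounds_of_inv_cube h.posC hz
  have key : ∀ x, (1 - k * (0.2 * deviation A B C)) * coneTerm k 1 1 1 x ≤
      coneTerm k A B C x := by
    intro x
    have hN3 := three_le_sideForm_one x
    have hN : sideForm 1 1 1 ((x.1 : ℝ) + 1) ((x.2 : ℝ) + 1) ≠ 0 := by linarith
    have hi : (0 : ℝ) < x.1 + 1 := by positivity
    have hj : (0 : ℝ) < x.2 + 1 := by positivity
    rw [coneTerm_one, coneTerm_eq]
    have e1 := sideForm_div_sum hN A B C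
    have d1 := tangent_le_inv_pow (lt_of_lt_of_le (by norm_num)
      (le_sideForm_div hi hj hA.1 hB.1 hC.2)) k
    have d2 := tangent_le_inv_pow (lt_of_lt_of_le (by norm_num)
      (le_sideForm_div hi hj hB.1 hC.1 hA.2)) k
    have d3 := tangent_le_inv_pow (lt_of_lt_of_le (by norm_num)
      (le_sideForm_div hi hj hC.1 hA.1 hB.2)) k
    have q1 := le_quadratic h.posA hA.2
    have q2 := le_quadratic h.posB hB.2
    have q3 := le_quadratic h.posC hC.2
    have hinv : 0 ≤ (sideForm 1 1 1 ((x.1 : ℝ) + 1) ((x.2 : ℝ) + 1) ^ k)⁻¹ := by positivity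
    rw [show ∀ u w : ℝ, (1 - u) * (3 * w) = w * (3 - 3 * u) by intros; ring]
    refine mul_le_mul_of_nonneg_left ?_ hinv
    have hm : A + B + C - 3 ≤ 0.6 * deviation A B C := by
      unfold deviation
      linarith
    have hm' := mul_le_mul_of_nonneg_left hm (Nat.cast_nonneg (α := ℝ) k)
    rw [← e1] at hm'
    linarith
  unfold coneSum
  rw [← tsum_mul_left]
  exact ((summable_coneTerm NonObtuse.one hk).mul_left _).tsum_le_tsum key
    (summable_coneTerm h hk)

theorem coneSum_three_le_of_far {A B C : ℝ} (h : NonObtuse A B C)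
    (hs : (A ^ 3)⁻¹ + (B ^ 3)⁻¹ + (C ^ 3)⁻¹ = 3) (hV : 0.8 ≤ deviation A B C) :
    coneSum 3 A B C ≤ 0.51 := by
  have hA := h.posA
  have hB := h.posB
  have hC := h.posC
  have key : coneSum 3 A B C ≤ _ := (summable_coneTerm h (k := 3) (by norm_num)).tsum_le_tsum
    (coneTerm_le h 3) ((summable_inv_mul_succ_pow (by norm_num)).mul_left _)
  rw [tsum_mul_left] at key
  obtain ⟨x, hx, hx0⟩ : ∃ x, x = (√A ^ 3)⁻¹ ∧ 0 < x := ⟨_, rfl, by positivity⟩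
  obtain ⟨y, hy, hy0⟩ : ∃ y, y = (√B ^ 3)⁻¹ ∧ 0 < y := ⟨_, rfl, by positivity⟩
  obtain ⟨z, hz, hz0⟩ : ∃ z, z = (√C ^ 3)⁻¹ ∧ 0 < z := ⟨_, rfl, by positivity⟩
  have sq : ∀ {D w : ℝ}, 0 < D → w = (√D ^ 3)⁻¹ → (D ^ 3)⁻¹ = w ^ 2 := by
    intro D w hD hw
    rw [hw, inv_pow, ← pow_mul, mul_comm 3 2, pow_mul, Real.sq_sqrt hD.le]
  unfold deviation at hV
  rw [sq hA hx, sq hB hy, sq hC hz] at hs hV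
  have e : ((2 * (√A * √B)) ^ 3)⁻¹ + ((2 * (√B * √C)) ^ 3)⁻¹ + ((2 * (√C * √A)) ^ 3)⁻¹ =
      (x * y + y * z + z * x) / 8 := by
    rw [hx, hy, hz]
    simp only [mul_pow, mul_inv]
    norm_num
    ring
  rw [e] at key
  have h1 : (x * y + y * z + z * x) ^ 2 ≤ 7.8 := by
    have h2 : (x ^ 2 + y ^ 2 + z ^ 2) ^ 2 = 9 := by rw [hs]; norm_num
    nlinarith [sq_nonneg (x * y - y * z), sq_nonneg (y * z - z * x), sq_nonneg (z * x - x * y)]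
  have h3 : x * y + y * z + z * x ≤ 2.8 := by
    by_contra! h3
    nlinarith
  have h4 := tsum_inv_mul_succ_cube_le
  have h5 : 0 ≤ x * y + y * z + z * x := by positivity
  nlinarith

/-- Half of the Epstein zeta value at `2 * k` of the lattice with Selling triangle `A`, `B`, `C`. -/
noncomputable def formSum (k : ℕ) (A B C : ℝ) : ℝ :=
  raySum k * ((A ^ k)⁻¹ + (B ^ k)⁻¹ + (C ^ k)⁻¹) + coneSum k A B C

theorem sideForm_smul (c A B C i j : ℝ) :
    sideForm (c * A) (c * B) (c * C) i j = c * sideForm A B C i j := by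
  unfold sideForm
  ring

theorem formSum_smul (k : ℕ) (c A B C : ℝ) :
    formSum k (c * A) (c * B) (c * C) = (c ^ k)⁻¹ * formSum k A B C := by
  unfold formSum coneSum
  rw [mul_add ((c ^ k)⁻¹), ← tsum_mul_left]
  congr 1
  · simp only [mul_pow, mul_inv]
    ring
  · congr 1
    ext x
    unfold coneTerm
    simp only [sideForm_smul, mul_pow, mul_inv]
    ring

theorem formSum_pos {A B C : ℝ} (h : NonObtuse A B C) {k : ℕ} (hk : 1 ≤ k) :
    0 < formSum k A B C := by
  have h1 := one_le_raySum hk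
  have h2 := coneSum_nonneg h k
  have hA := h.posA
  have hB := h.posB
  have hC := h.posC
  have : 0 < raySum k * ((A ^ k)⁻¹ + (B ^ k)⁻¹ + (C ^ k)⁻¹) :=
    mul_pos (by linarith) (by positivity)
  unfold formSum
  linarith

theorem linear_le_three_mul_pow {a : ℝ} (ha : 0 ≤ a) (n : ℕ) :
    ((n : ℝ) + 3) * a ^ 3 - n ≤ 3 * a ^ (n + 3) := by
  induction n with
  | zero => simp
  | succ n ih =>
    have h1 := mul_le_mul_of_nonneg_left ih ha
    have h2 : 0 ≤ (a - 1) ^ 2 * ((n + 3) * a ^ 2 + (n + 2) * a + (n + 1)) := by positivity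
    have h3 : 3 * a ^ (n + 1 + 3) = a * (3 * a ^ (n + 3)) := by ring
    rw [h3]
    push_cast
    nlinarith

theorem quadratic_le_inv_pow {A : ℝ} (hA : 0 < A) (n : ℕ) :
    1 + ((n : ℝ) + 6) / 3 * ((A ^ 3)⁻¹ - 1) + ((n : ℝ) + 3) / 3 * ((A ^ 3)⁻¹ - 1) ^ 2 ≤
      (A ^ (n + 6))⁻¹ := by
  have ha : 0 ≤ A⁻¹ := by positivity
  have h1 := mul_le_mul_of_nonneg_left (linear_le_three_mul_pow ha n) (pow_nonneg ha 3)
  have h2 : (A ^ (n + 6))⁻¹ = A⁻¹ ^ 3 * A⁻¹ ^ (n + 3) := by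
    rw [← inv_pow]
    ring
  rw [h2, ← inv_pow]
  nlinarith

theorem affine_pow_lt {m M θ : ℝ} (hm : 0 < m) (hM : 0 < M) (h0 : 0 < θ) (h1 : θ ≤ 1) {k : ℕ}
    (hk : 3 ≤ k) (h : m ^ k < M ^ 3) : (1 + θ * (m - 1)) ^ k < (1 + θ * (M - 1)) ^ 3 := by
  have root : ∀ {w : ℝ}, 0 ≤ w → w ^ k = (w ^ ((k : ℝ) / 3)) ^ 3 := by
    intro w hw
    rw [← Real.rpow_natCast (w ^ ((k : ℝ) / 3)) 3, ← Real.rpow_mul hw, ← Real.rpow_natCast]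
    congr 1
    push_cast
    ring
  have hp : 1 ≤ (k : ℝ) / 3 := by
    have : (3 : ℝ) ≤ k := by exact_mod_cast hk
    linarith
  have hmM : m ^ ((k : ℝ) / 3) < M := by
    rw [root hm.le] at h
    exact lt_of_pow_lt_pow_left₀ 3 hM.le h
  have hc := (convexOn_rpow hp).2 (x := 1) (y := m) (by simp) (by simpa using hm.le)
    (sub_nonneg.2 h1) h0.le (by ring)
  simp only [smul_eq_mul, Real.one_rpow, mul_one] at hc
  have e : 1 + θ * (m - 1) = 1 - θ + θ * m := by ring
  have hpos : 0 ≤ 1 - θ + θ * m := by nlinarith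
  rw [e, root hpos]
  refine pow_lt_pow_left₀ ?_ (by positivity) (by norm_num)
  nlinarith

theorem formSum_ratio_lt_of_normalized {A B C : ℝ} (h : NonObtuse A B C)
    (hs : (A ^ 3)⁻¹ + (B ^ 3)⁻¹ + (C ^ 3)⁻¹ = 3) (hV : 0 < deviation A B C) {k : ℕ}
    (hk : 7 ≤ k) (hk' : k ≤ 12) :
    formSum 3 A B C ^ k * formSum k 1 1 1 ^ 3 < formSum k A B C ^ 3 * formSum 3 1 1 1 ^ k := by
  have hz3 := one_le_raySum (k := 3) (by norm_num)
  have hzk := one_le_raySum (k := k) (by omega)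
  have hT3 := coneSum_one_three_le
  have hT3' := coneSum_one_three_ge
  have hTk := coneSum_one_le hk
  have hTk' := coneSum_nonneg NonObtuse.one k
  have hp3 := formSum_pos h (k := 3) (by norm_num)
  have hpk := formSum_pos h (k := k) (by omega)
  have hp3' := formSum_pos NonObtuse.one (k := 3) (by norm_num)
  have hpk' := formSum_pos NonObtuse.one (k := k) (by omega)
  set V := deviation A B C with hVdef
  have hgk : 3 + ((k : ℝ) - 3) / 3 * V ≤ (A ^ k)⁻¹ + (B ^ k)⁻¹ + (C ^ k)⁻¹ := by
    obtain ⟨n, rfl⟩ : ∃ n, k = n + 6 := ⟨k - 6, by omega⟩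
    have h1 := quadratic_le_inv_pow h.posA n
    have h2 := quadratic_le_inv_pow h.posB n
    have h3 := quadratic_le_inv_pow h.posC n
    rw [hVdef]
    unfold deviation
    push_cast
    have e : ((n : ℝ) + 6) / 3 * (((A ^ 3)⁻¹ - 1) + ((B ^ 3)⁻¹ - 1) + ((C ^ 3)⁻¹ - 1)) = 0 := by
      rw [show ((A ^ 3)⁻¹ - 1) + ((B ^ 3)⁻¹ - 1) + ((C ^ 3)⁻¹ - 1) = 0 by linarith, mul_zero]
    nlinarith
  have hkr : (7 : ℝ) ≤ k := by exact_mod_cast hk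
  have hkr' : (k : ℝ) ≤ 12 := by exact_mod_cast hk'
  have e3 : formSum 3 1 1 1 = 3 * raySum 3 + coneSum 3 1 1 1 := by
    unfold formSum; norm_num; ring
  have ek : formSum k 1 1 1 = 3 * raySum k + coneSum k 1 1 1 := by
    unfold formSum; norm_num; ring
  suffices H : ∃ θ : ℝ, 0 < θ ∧ θ ≤ 1 ∧
      formSum 3 A B C ≤ (1 + θ * (1.132 - 1)) * formSum 3 1 1 1 ∧
      (1 + θ * ((1 + 0.088 * (k - 3)) - 1)) * formSum k 1 1 1 ≤ formSum k A B C by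
    obtain ⟨θ, h0, h1, H3, Hk⟩ := H
    have hnum : (1.132 : ℝ) ^ k < (1 + 0.088 * (k - 3)) ^ 3 := by
      interval_cases k <;> norm_num
    have haff := affine_pow_lt (by norm_num) (by linarith) h0 h1 (by omega) hnum
    have hb : 0 < 1 + θ * ((1 + 0.088 * ((k : ℝ) - 3)) - 1) := by nlinarith
    calc formSum 3 A B C ^ k * formSum k 1 1 1 ^ 3
        ≤ ((1 + θ * (1.132 - 1)) * formSum 3 1 1 1) ^ k * formSum k 1 1 1 ^ 3 := by gcongr
      _ = (1 + θ * (1.132 - 1)) ^ k * (formSum 3 1 1 1 ^ k * formSum k 1 1 1 ^ 3) := by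
        rw [mul_pow]
        ring
      _ < (1 + θ * ((1 + 0.088 * (k - 3)) - 1)) ^ 3 *
          (formSum 3 1 1 1 ^ k * formSum k 1 1 1 ^ 3) :=
        mul_lt_mul_of_pos_right haff (by positivity)
      _ = ((1 + θ * ((1 + 0.088 * (k - 3)) - 1)) * formSum k 1 1 1) ^ 3 *
          formSum 3 1 1 1 ^ k := by ring
      _ ≤ formSum k A B C ^ 3 * formSum 3 1 1 1 ^ k := by gcongr
  have hfk : raySum k * (3 + ((k : ℝ) - 3) / 3 * V) + coneSum k A B C ≤ formSum k A B C := by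
    unfold formSum
    gcongr
  have hf3 : formSum 3 A B C = 3 * raySum 3 + coneSum 3 A B C := by
    unfold formSum
    rw [hs]
    ring
  have hkV : 0 ≤ ((k : ℝ) - 3) * V := mul_nonneg (by linarith) hV.le
  have hzkV := mul_le_mul_of_nonneg_right hzk hkV
  have hTkV := mul_le_mul_of_nonneg_right hTk hkV
  have hTkV0 := mul_nonneg hTk' hV.le
  have hTkV1 := mul_le_mul_of_nonneg_right hTk hV.le
  rw [e3, ek, hf3]
  rcases le_total V 0.8 with hle | hge
  · refine ⟨V / 0.8, by positivity, by rw [div_le_one (by norm_num)]; exact hle, ?_, ?_⟩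
    · have h1 := coneSum_three_le h hs hle
      have h2 := mul_le_mul_of_nonneg_right hT3 hV.le
      have h3 := mul_le_mul_of_nonneg_right hz3 hV.le
      rw [← hVdef] at h1
      rw [show V / 0.8 * (1.132 - 1) = 0.165 * V by ring]
      linarith
    · have h1 := coneSum_ge h hs hle (k := k) (by omega)
      refine le_trans ?_ ((add_le_add_right h1 _).trans hfk)
      have h2 : (k : ℝ) * (coneSum k 1 1 1 * V) ≤ 12 * (coneSum k 1 1 1 * V) :=
        mul_le_mul_of_nonneg_right hkr' hTkV0
      have h3 : 4 * V ≤ ((k : ℝ) - 3) * V := mul_le_mul_of_nonneg_right (by linarith) hV.le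
      rw [← hVdef, show V / 0.8 * (1 + 0.088 * ((k : ℝ) - 3) - 1) = 0.11 * (((k : ℝ) - 3) * V) by
        ring]
      linarith
  · refine ⟨1, by norm_num, le_rfl, ?_, ?_⟩
    · have h1 := coneSum_three_le_of_far h hs hge
      linarith
    · have h1 := coneSum_nonneg h k
      refine le_trans ?_ hfk
      have h3 : ((k : ℝ) - 3) * 0.8 ≤ ((k : ℝ) - 3) * V :=
        mul_le_mul_of_nonneg_left hge (by linarith)
      have h4 := mul_le_mul_of_nonneg_left h3 (show 0 ≤ raySum k by linarith)
      have h5 := mul_le_mul_of_nonneg_right hTk (show 0 ≤ (k : ℝ) - 3 by linarith)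
      have h6 := mul_le_mul_of_nonneg_right hzk (show 0 ≤ (k : ℝ) - 3 by linarith)
      linarith

theorem formSum_ratio_lt {A B C : ℝ} (h : NonObtuse A B C) (hne : ¬(A = B ∧ B = C)) {k : ℕ}
    (hk : 7 ≤ k) (hk' : k ≤ 12) :
    formSum 3 A B C ^ k * formSum k 1 1 1 ^ 3 < formSum k A B C ^ 3 * formSum 3 1 1 1 ^ k := by
  have hA := h.posA
  have hB := h.posB
  have hC := h.posC
  obtain ⟨g, hg, hg0⟩ : ∃ g, g = ((A ^ 3)⁻¹ + (B ^ 3)⁻¹ + (C ^ 3)⁻¹) / 3 ∧ 0 < g :=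
    ⟨_, rfl, by positivity⟩
  obtain ⟨c, hc, hc0⟩ : ∃ c : ℝ, c ^ 3 = g ∧ 0 < c := by
    refine ⟨g ^ (1 / 3 : ℝ), ?_, by positivity⟩
    rw [← Real.rpow_natCast, ← Real.rpow_mul hg0.le]
    norm_num
  have hs : ((c * A) ^ 3)⁻¹ + ((c * B) ^ 3)⁻¹ + ((c * C) ^ 3)⁻¹ = 3 := by
    simp only [mul_pow, mul_inv, hc]
    have : (A ^ 3)⁻¹ + (B ^ 3)⁻¹ + (C ^ 3)⁻¹ = 3 * g := by rw [hg]; ring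
    rw [← mul_add, ← mul_add, this]
    field_simp
  have hV : 0 < deviation (c * A) (c * B) (c * C) := by
    unfold deviation
    by_contra! hV
    apply hne
    have hx := sq_nonneg (((c * A) ^ 3)⁻¹ - 1)
    have hy := sq_nonneg (((c * B) ^ 3)⁻¹ - 1)
    have hz := sq_nonneg (((c * C) ^ 3)⁻¹ - 1)
    have one : ∀ {D : ℝ}, 0 < D → (((c * D) ^ 3)⁻¹ - 1) ^ 2 = 0 → c * D = 1 := by
      intro D hD h0
      have h1 : ((c * D) ^ 3)⁻¹ = 1 := by
        have := pow_eq_zero_iff (two_ne_zero) |>.1 h0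
        linarith
      rw [inv_eq_one] at h1
      exact (pow_eq_one_iff_of_nonneg (by positivity) (by norm_num)).1 h1
    have a1 := one hA (by linarith)
    have b1 := one hB (by linarith)
    have c1 := one hC (by linarith)
    exact ⟨mul_left_cancel₀ hc0.ne' (a1.trans b1.symm),
      mul_left_cancel₀ hc0.ne' (b1.trans c1.symm)⟩
  have key := formSum_ratio_lt_of_normalized (h.smul hc0) hs hV hk hk'
  rw [formSum_smul, formSum_smul] at key
  have e1 : ((c ^ 3)⁻¹ * formSum 3 A B C) ^ k * formSum k 1 1 1 ^ 3 =
      ((c ^ (3 * k))⁻¹) * (formSum 3 A B C ^ k * formSum k 1 1 1 ^ 3) := by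
    rw [mul_pow, inv_pow, ← pow_mul]
    ring
  have e2 : ((c ^ k)⁻¹ * formSum k A B C) ^ 3 * formSum 3 1 1 1 ^ k =
      ((c ^ (3 * k))⁻¹) * (formSum k A B C ^ 3 * formSum 3 1 1 1 ^ k) := by
    rw [mul_pow, inv_pow, ← pow_mul, mul_comm k 3]
    ring
  rw [e1, e2] at key
  exact lt_of_mul_lt_mul_left key (by positivity)

/-- Integer coordinates of the vector with coordinates `(i, j)` in the `k`-th of the six cones
cut out by the minimal vectors of a reduced basis. -/
def coneIndex (k : Fin 6) (i j : ℤ) : ℤ × ℤ :=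
  ![(i, j), (-j, i + j), (-i - j, i), (-i, -j), (j, -i - j), (i + j, -i)] k

/-- Coordinates inside a half-open cone, the boundary ray being listed separately. -/
def rayOrCone : ℕ ⊕ ℕ × ℕ → ℤ × ℤ
  | .inl a => (a + 1, 0)
  | .inr x => (x.1 + 1, x.2 + 1)

theorem rayOrCone_spec (x : ℕ ⊕ ℕ × ℕ) : 0 < (rayOrCone x).1 ∧ 0 ≤ (rayOrCone x).2 := by
  rcases x with a | ⟨a, b⟩ <;> simp only [rayOrCone] <;> omega

theorem rayOrCone_injective : Function.Injective rayOrCone := by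
  rintro (a | ⟨a, b⟩) (c | ⟨c, d⟩) h <;> simp [rayOrCone] at h ⊢ <;> omega

theorem exists_rayOrCone {i j : ℤ} (hi : 0 < i) (hj : 0 ≤ j) : ∃ x, rayOrCone x = (i, j) := by
  rcases hj.eq_or_lt with rfl | hj
  · exact ⟨.inl (i - 1).toNat, by simp [rayOrCone]; omega⟩
  · exact ⟨.inr ((i - 1).toNat, (j - 1).toNat), by simp [rayOrCone]; omega⟩

theorem coneIndex_inj {k l : Fin 6} {i j i' j' : ℤ} (hi : 0 < i) (hj : 0 ≤ j) (hi' : 0 < i')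
    (hj' : 0 ≤ j') (h : coneIndex k i j = coneIndex l i' j') : k = l ∧ i = i' ∧ j = j' := by
  fin_cases k <;> fin_cases l <;> simp [coneIndex] at h ⊢ <;> omega

theorem coneIndex_ne_zero (k : Fin 6) {i j : ℤ} (hi : 0 < i) (hj : 0 ≤ j) :
    coneIndex k i j ≠ 0 := by
  intro h
  fin_cases k <;> simp [coneIndex, Prod.ext_iff] at h <;> omega

theorem exists_coneIndex {z : ℤ × ℤ} (hz : z ≠ 0) :
    ∃ (k : Fin 6) (i j : ℤ), 0 < i ∧ 0 ≤ j ∧ coneIndex k i j = z := by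
  obtain ⟨m, n⟩ := z
  have h0 : m ≠ 0 ∨ n ≠ 0 := by
    by_contra! h
    exact hz (by simp [h.1, h.2])
  by_cases c0 : 1 ≤ m ∧ 0 ≤ n
  · exact ⟨0, m, n, by omega, by omega, by simp [coneIndex]⟩
  by_cases c1 : m ≤ 0 ∧ 1 ≤ m + n
  · exact ⟨1, m + n, -m, by omega, by omega, by simp [coneIndex]⟩
  by_cases c2 : 1 ≤ n ∧ m + n ≤ 0
  · exact ⟨2, n, -m - n, by omega, by omega, by simp [coneIndex]; ring⟩
  by_cases c3 : m ≤ -1 ∧ n ≤ 0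
  · exact ⟨3, -m, -n, by omega, by omega, by simp [coneIndex]⟩
  by_cases c4 : 0 ≤ m ∧ m + n ≤ -1
  · exact ⟨4, -m - n, m, by omega, by omega, by simp [coneIndex]⟩
  · exact ⟨5, -n, m + n, by omega, by omega, by simp [coneIndex]⟩

theorem norm_sq_eq_coords (p : EuclideanSpace ℝ (Fin 2)) : ‖p‖ ^ 2 = p 0 ^ 2 + p 1 ^ 2 := by
  rw [EuclideanSpace.real_norm_sq_eq, Fin.sum_univ_two]

theorem norm_sq_combination (u v : EuclideanSpace ℝ (Fin 2)) (m n : ℝ) :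
    ‖m • u + n • v‖ ^ 2 =
      m ^ 2 * ‖u‖ ^ 2 + n ^ 2 * ‖v‖ ^ 2 + m * n * (‖u‖ ^ 2 + ‖v‖ ^ 2 - ‖u - v‖ ^ 2) := by
  simp only [norm_sq_eq_coords, PiLp.add_apply, PiLp.smul_apply, PiLp.sub_apply, smul_eq_mul]
  ring

theorem combination_eq_zero {u v : EuclideanSpace ℝ (Fin 2)} (h : det2 u v ≠ 0) {m n : ℝ}
    (h0 : m • u + n • v = 0) : m = 0 ∧ n = 0 := by
  have e0 : m * u 0 + n * v 0 = 0 := by simpa using congrArg (fun p => p 0) h0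
  have e1 : m * u 1 + n * v 1 = 0 := by simpa using congrArg (fun p => p 1) h0
  constructor
  · have : m * det2 u v = 0 := by unfold det2; linear_combination v 1 * e0 - v 0 * e1
    exact (mul_eq_zero.1 this).resolve_right h
  · have : n * det2 u v = 0 := by unfold det2; linear_combination u 0 * e1 - u 1 * e0
    exact (mul_eq_zero.1 this).resolve_right h

/-- The lattice point with given cone coordinates. -/
noncomputable def conePoint (u v : EuclideanSpace ℝ (Fin 2)) (x : Fin 6 × (ℕ ⊕ ℕ × ℕ)) :
    EuclideanSpace ℝ (Fin 2) :=
  ((coneIndex x.1 (rayOrCone x.2).1 (rayOrCone x.2).2).1 : ℝ) • u +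
    ((coneIndex x.1 (rayOrCone x.2).1 (rayOrCone x.2).2).2 : ℝ) • v

theorem conePoint_bijOn {u v : EuclideanSpace ℝ (Fin 2)} (h : det2 u v ≠ 0) :
    Set.BijOn (conePoint u v) Set.univ (latticeSet u v \ {0}) := by
  refine ⟨?_, ?_, ?_⟩
  · rintro ⟨k, x⟩ -
    refine ⟨⟨_, _, rfl⟩, fun h0 => ?_⟩
    have := combination_eq_zero h h0
    refine coneIndex_ne_zero k (rayOrCone_spec x).1 (rayOrCone_spec x).2 (Prod.ext ?_ ?_)
    · exact_mod_cast this.1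
    · exact_mod_cast this.2
  · rintro ⟨k, x⟩ - ⟨l, y⟩ - hxy
    have h0 : ((((coneIndex k (rayOrCone x).1 (rayOrCone x).2).1 : ℝ) -
        (coneIndex l (rayOrCone y).1 (rayOrCone y).2).1)) • u +
        (((coneIndex k (rayOrCone x).1 (rayOrCone x).2).2 : ℝ) -
        (coneIndex l (rayOrCone y).1 (rayOrCone y).2).2) • v = 0 := by
      simp only [conePoint] at hxy
      rw [sub_smul, sub_smul, sub_add_sub_comm, hxy, sub_self]
    have h1 := combination_eq_zero h h0
    have h2 : coneIndex k (rayOrCone x).1 (rayOrCone x).2 =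
        coneIndex l (rayOrCone y).1 (rayOrCone y).2 := by
      refine Prod.ext ?_ ?_
      · exact_mod_cast sub_eq_zero.1 h1.1
      · exact_mod_cast sub_eq_zero.1 h1.2
    obtain ⟨h3, h4, h5⟩ := coneIndex_inj (rayOrCone_spec x).1 (rayOrCone_spec x).2
      (rayOrCone_spec y).1 (rayOrCone_spec y).2 h2
    exact Prod.ext h3 (rayOrCone_injective (Prod.ext h4 h5))
  · rintro p ⟨⟨m, n, rfl⟩, hp⟩
    have hz : ((m, n) : ℤ × ℤ) ≠ 0 := by
      intro hz
      simp only [Prod.mk_eq_zero] at hz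
      apply hp
      simp [hz.1, hz.2]
    obtain ⟨k, i, j, hi, hj, hk⟩ := exists_coneIndex hz
    obtain ⟨x, hx⟩ := exists_rayOrCone hi hj
    exact ⟨(k, x), trivial, by simp [conePoint, hx, hk]⟩

theorem norm_sq_conePoint (u v : EuclideanSpace ℝ (Fin 2)) (k : Fin 6) (x : ℕ ⊕ ℕ × ℕ) :
    ‖conePoint u v (k, x)‖ ^ 2 =
      ![sideForm (‖u‖ ^ 2) (‖v‖ ^ 2) (‖u - v‖ ^ 2) (rayOrCone x).1 (rayOrCone x).2,
        sideForm (‖v‖ ^ 2) (‖u - v‖ ^ 2) (‖u‖ ^ 2) (rayOrCone x).1 (rayOrCone x).2,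
        sideForm (‖u - v‖ ^ 2) (‖u‖ ^ 2) (‖v‖ ^ 2) (rayOrCone x).1 (rayOrCone x).2,
        sideForm (‖u‖ ^ 2) (‖v‖ ^ 2) (‖u - v‖ ^ 2) (rayOrCone x).1 (rayOrCone x).2,
        sideForm (‖v‖ ^ 2) (‖u - v‖ ^ 2) (‖u‖ ^ 2) (rayOrCone x).1 (rayOrCone x).2,
        sideForm (‖u - v‖ ^ 2) (‖u‖ ^ 2) (‖v‖ ^ 2) (rayOrCone x).1 (rayOrCone x).2] k := by
  unfold conePoint
  rw [norm_sq_combination]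
  fin_cases k <;> simp [coneIndex, sideForm] <;> ring

theorem NonObtuse.summable_inv_sideForm_pow {A B C : ℝ} (h : NonObtuse A B C) {k : ℕ}
    (hk : 2 ≤ k) :
    Summable fun x : ℕ × ℕ => (sideForm A B C ((x.1 : ℝ) + 1) ((x.2 : ℝ) + 1) ^ k)⁻¹ := by
  refine Summable.of_nonneg_of_le (fun x => ?_)
    (fun x => h.inv_sideForm_pow_le k (by positivity) (by positivity))
    ((summable_inv_mul_succ_pow hk).mul_left _)
  have := h.sideForm_pos (i := x.1 + 1) (j := x.2 + 1) (by positivity) (by positivity)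
  positivity

/-- The contribution of a half-open cone. -/
noncomputable def halfConeSum (k : ℕ) (A B C : ℝ) : ℝ :=
  raySum k * (A ^ k)⁻¹ +
    ∑' x : ℕ × ℕ, (sideForm A B C ((x.1 : ℝ) + 1) ((x.2 : ℝ) + 1) ^ k)⁻¹

theorem hasSum_halfCone {A B C : ℝ} (h : NonObtuse A B C) {k : ℕ} (hk : 2 ≤ k) :
    HasSum (fun x => (sideForm A B C (rayOrCone x).1 (rayOrCone x).2 ^ k)⁻¹)
      (halfConeSum k A B C) := by
  refine HasSum.sum ?_ ?_
  · have := (summable_inv_succ_pow (k := 2 * k) (by omega)).hasSum.mul_right ((A ^ k)⁻¹)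
    refine this.congr_fun fun n => ?_
    simp [rayOrCone, sideForm, pow_mul, mul_pow, sq]
    ring
  · refine (h.summable_inv_sideForm_pow hk).hasSum.congr_fun fun x => ?_
    simp [rayOrCone]

theorem formSum_eq_halfConeSum {A B C : ℝ} (h : NonObtuse A B C) {k : ℕ} (hk : 2 ≤ k) :
    formSum k A B C = halfConeSum k A B C + halfConeSum k B C A + halfConeSum k C A B := by
  have h1 := h.summable_inv_sideForm_pow hk
  have h2 := h.rotate.summable_inv_sideForm_pow hk
  have h3 := h.rotate.rotate.summable_inv_sideForm_pow hk
  unfold formSum coneSum coneTerm halfConeSum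
  rw [Summable.tsum_add (h1.add h2) h3, Summable.tsum_add h1 h2]
  ring

theorem hasSum_conePoint {u v : EuclideanSpace ℝ (Fin 2)}
    (h : NonObtuse (‖u‖ ^ 2) (‖v‖ ^ 2) (‖u - v‖ ^ 2)) {k : ℕ} (hk : 2 ≤ k) :
    HasSum (fun x => ((‖conePoint u v x‖ ^ 2) ^ k)⁻¹)
      (2 * formSum k (‖u‖ ^ 2) (‖v‖ ^ 2) (‖u - v‖ ^ 2)) := by
  have h1 := hasSum_halfCone h hk
  have h2 := hasSum_halfCone h.rotate hk
  have h3 := hasSum_halfCone h.rotate.rotate hk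
  have hfib : ∀ i : Fin 6, HasSum (fun x => ((‖conePoint u v (i, x)‖ ^ 2) ^ k)⁻¹)
      (![halfConeSum k (‖u‖ ^ 2) (‖v‖ ^ 2) (‖u - v‖ ^ 2),
        halfConeSum k (‖v‖ ^ 2) (‖u - v‖ ^ 2) (‖u‖ ^ 2),
        halfConeSum k (‖u - v‖ ^ 2) (‖u‖ ^ 2) (‖v‖ ^ 2),
        halfConeSum k (‖u‖ ^ 2) (‖v‖ ^ 2) (‖u - v‖ ^ 2),
        halfConeSum k (‖v‖ ^ 2) (‖u - v‖ ^ 2) (‖u‖ ^ 2),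
        halfConeSum k (‖u - v‖ ^ 2) (‖u‖ ^ 2) (‖v‖ ^ 2)] i) := by
    intro i
    simp only [norm_sq_conePoint]
    fin_cases i
    · exact h1
    · exact h2
    · exact h3
    · exact h1
    · exact h2
    · exact h3
  have hs : Summable fun x => ((‖conePoint u v x‖ ^ 2) ^ k)⁻¹ :=
    (summable_prod_of_nonneg fun x => by positivity).2
      ⟨fun i => (hfib i).summable, Summable.of_finite⟩
  convert hs.hasSum using 1
  rw [hs.tsum_prod, tsum_fintype]
  simp only [fun i => (hfib i).tsum_eq]
  simp only [Fin.sum_univ_six, formSum_eq_halfConeSum h hk]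
  simp
  ring

theorem hasSum_lattice {u v : EuclideanSpace ℝ (Fin 2)} (hd : det2 u v ≠ 0)
    (h : NonObtuse (‖u‖ ^ 2) (‖v‖ ^ 2) (‖u - v‖ ^ 2)) {k : ℕ} (hk : 2 ≤ k) :
    HasSum (fun p : ↥(latticeSet u v \ {0}) =>
        ‖(p : EuclideanSpace ℝ (Fin 2))‖ ^ (-((2 * k : ℕ) : ℝ)))
      (2 * formSum k (‖u‖ ^ 2) (‖v‖ ^ 2) (‖u - v‖ ^ 2)) := by
  have := hasSum_conePoint h hk
  refine (((Equiv.Set.univ _).symm.trans (Set.BijOn.equiv _ (conePoint_bijOn hd))).hasSum_iff).1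
    (this.congr_fun fun x => ?_)
  change ‖conePoint u v x‖ ^ (-((2 * k : ℕ) : ℝ)) = _
  rw [Real.rpow_neg (norm_nonneg _), Real.rpow_natCast, pow_mul]

theorem latticeSet_sq_le {u v : EuclideanSpace ℝ (Fin 2)} (m n : ℝ) :
    det2 u v ^ 2 * (m ^ 2 + n ^ 2) ≤ (‖u‖ ^ 2 + ‖v‖ ^ 2) * ‖m • u + n • v‖ ^ 2 := by
  simp only [norm_sq_eq_coords, PiLp.add_apply, PiLp.smul_apply, smul_eq_mul, det2]
  nlinarith [sq_nonneg (m * (u 0 ^ 2 + u 1 ^ 2) + n * (u 0 * v 0 + u 1 * v 1)),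
    sq_nonneg (n * (v 0 ^ 2 + v 1 ^ 2) + m * (u 0 * v 0 + u 1 * v 1))]

theorem finite_latticeSet_inter {u v : EuclideanSpace ℝ (Fin 2)} (h : det2 u v ≠ 0) (R : ℝ) :
    {p ∈ latticeSet u v | ‖p‖ ^ 2 ≤ R}.Finite := by
  obtain ⟨N, hN⟩ := exists_nat_gt ((‖u‖ ^ 2 + ‖v‖ ^ 2) * R / det2 u v ^ 2)
  have hd : 0 < det2 u v ^ 2 := by positivity
  rw [div_lt_iff₀ hd] at hN
  refine (((Set.finite_Icc (-(N : ℤ)) N).prod (Set.finite_Icc (-(N : ℤ)) N)).image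
    (fun z : ℤ × ℤ => (z.1 : ℝ) • u + (z.2 : ℝ) • v)).subset ?_
  rintro _ ⟨⟨m, n, rfl⟩, hp⟩
  have h1 := latticeSet_sq_le (u := u) (v := v) m n
  have h2 := mul_le_mul_of_nonneg_left hp (show 0 ≤ ‖u‖ ^ 2 + ‖v‖ ^ 2 by positivity)
  have h3 : (m : ℝ) ^ 2 + n ^ 2 < N := lt_of_mul_lt_mul_left (by linarith) hd.le
  have h4 : m ^ 2 + n ^ 2 < (N : ℤ) := by exact_mod_cast h3
  refine ⟨(m, n), ⟨⟨?_, ?_⟩, ⟨?_, ?_⟩⟩, rfl⟩ <;> simp only <;>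
    nlinarith [Int.le_self_sq m, Int.le_self_sq n, Int.le_self_sq (-m), Int.le_self_sq (-n),
      sq_nonneg m, sq_nonneg n]

theorem latticeSet_neg_right (u v : EuclideanSpace ℝ (Fin 2)) :
    latticeSet u (-v) = latticeSet u v := by
  ext p
  constructor
  · rintro ⟨m, n, rfl⟩
    exact ⟨m, -n, by simp⟩
  · rintro ⟨m, n, rfl⟩
    exact ⟨m, -n, by simp⟩

theorem latticeSet_sub_right (u v : EuclideanSpace ℝ (Fin 2)) :
    latticeSet u (v - u) = latticeSet u v := by
  ext p
  constructor
  · rintro ⟨m, n, rfl⟩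
    exact ⟨m - n, n, by push_cast; module⟩
  · rintro ⟨m, n, rfl⟩
    exact ⟨m + n, n, by push_cast; module⟩

theorem latticeSet_comm (u v : EuclideanSpace ℝ (Fin 2)) :
    latticeSet v u = latticeSet u v := by
  ext p
  constructor <;> rintro ⟨m, n, rfl⟩ <;> exact ⟨n, m, add_comm _ _⟩

/-- Every planar lattice has a basis spanning a triangle without obtuse angle. -/
theorem IsLattice2.exists_nonObtuse {L : Set (EuclideanSpace ℝ (Fin 2))} (hL : IsLattice2 L) :
    ∃ u v : EuclideanSpace ℝ (Fin 2), det2 u v ≠ 0 ∧ L = latticeSet u v ∧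
      NonObtuse (‖u‖ ^ 2) (‖v‖ ^ 2) (‖u - v‖ ^ 2) := by
  obtain ⟨u₀, v₀, hd₀, hL₀⟩ := hL
  let f : EuclideanSpace ℝ (Fin 2) × EuclideanSpace ℝ (Fin 2) → ℝ :=
    fun x => ‖x.1‖ ^ 2 + ‖x.2‖ ^ 2 + ‖x.1 - x.2‖ ^ 2
  let S : Set (EuclideanSpace ℝ (Fin 2) × EuclideanSpace ℝ (Fin 2)) :=
    {x | det2 x.1 x.2 ≠ 0 ∧ L = latticeSet x.1 x.2 ∧ f x ≤ f (u₀, v₀)}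
  have hS : S.Finite := by
    refine ((finite_latticeSet_inter hd₀ (f (u₀, v₀))).prod
      (finite_latticeSet_inter hd₀ (f (u₀, v₀)))).subset ?_
    rintro ⟨u, v⟩ ⟨-, hl, hf⟩
    rw [← hL₀, hl]
    simp only [f] at hf ⊢
    have hu := sq_nonneg ‖u‖
    have hv := sq_nonneg ‖v‖
    have hw := sq_nonneg ‖u - v‖
    exact ⟨⟨⟨1, 0, by simp⟩, by linarith⟩, ⟨⟨0, 1, by simp⟩, by linarith⟩⟩
  obtain ⟨⟨u, v⟩, ⟨hd, hl, hf⟩, hmin⟩ := Set.exists_min_image S f hS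
    ⟨(u₀, v₀), hd₀, hL₀, le_rfl⟩
  have hmin' : ∀ u' v', det2 u' v' ≠ 0 → latticeSet u' v' = latticeSet u v →
      f (u, v) ≤ f (u', v') := by
    intro u' v' h1 h2
    by_contra! h3
    exact h3.not_ge (hmin (u', v') ⟨h1, hl.trans h2.symm, h3.le.trans hf⟩)
  have h1 := hmin' u (-v) (fun h => hd (by simp [det2] at h ⊢; linarith)) (latticeSet_neg_right u v)
  have h2 := hmin' v (u - v) (fun h => hd (by simp [det2] at h ⊢; linarith))
    ((latticeSet_sub_right v u).trans (latticeSet_comm u v))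
  have h3 := hmin' u (v - u) (fun h => hd (by simp [det2] at h ⊢; linarith))
    (latticeSet_sub_right u v)
  have hu : u ≠ 0 := by
    rintro rfl
    simp [det2] at hd
  have hv : v ≠ 0 := by
    rintro rfl
    simp [det2] at hd
  have huv : u - v ≠ 0 := by
    intro h
    obtain rfl := sub_eq_zero.1 h
    exact hd (by simp [det2, mul_comm])
  refine ⟨u, v, hd, hl, by positivity, by positivity, by positivity, ?_, ?_, ?_⟩
  all_goals
    simp only [f, norm_sq_eq_coords, PiLp.sub_apply, PiLp.neg_apply] at h1 h2 h3 ⊢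
    nlinarith

theorem epsteinZeta_latticeSet {u v : EuclideanSpace ℝ (Fin 2)} (hd : det2 u v ≠ 0)
    (h : NonObtuse (‖u‖ ^ 2) (‖v‖ ^ 2) (‖u - v‖ ^ 2)) {k : ℕ} (hk : 2 ≤ k) :
    epsteinZeta (latticeSet u v) ((2 * k : ℕ) : ℝ) =
      2 * formSum k (‖u‖ ^ 2) (‖v‖ ^ 2) (‖u - v‖ ^ 2) :=
  (hasSum_lattice hd h hk).tsum_eq

theorem LJenergy_latticeSet (a b : ℝ) {u v : EuclideanSpace ℝ (Fin 2)} (hd : det2 u v ≠ 0)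
    (h : NonObtuse (‖u‖ ^ 2) (‖v‖ ^ 2) (‖u - v‖ ^ 2)) {k l : ℕ} (hk : 2 ≤ k) (hl : 2 ≤ l) :
    LJenergy a b ((2 * k : ℕ) : ℝ) ((2 * l : ℕ) : ℝ) (latticeSet u v) =
      a * (2 * formSum k (‖u‖ ^ 2) (‖v‖ ^ 2) (‖u - v‖ ^ 2)) -
        b * (2 * formSum l (‖u‖ ^ 2) (‖v‖ ^ 2) (‖u - v‖ ^ 2)) :=
  (((hasSum_lattice hd h hk).mul_left a).sub ((hasSum_lattice hd h hl).mul_left b)).tsum_eq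

theorem image_latticeSet {F : Type*} [FunLike F (EuclideanSpace ℝ (Fin 2))
    (EuclideanSpace ℝ (Fin 2))] [LinearMapClass F ℝ (EuclideanSpace ℝ (Fin 2))
    (EuclideanSpace ℝ (Fin 2))] (φ : F) (u v : EuclideanSpace ℝ (Fin 2)) :
    φ '' latticeSet u v = latticeSet (φ u) (φ v) := by
  ext p
  constructor
  · rintro ⟨_, ⟨m, n, rfl⟩, rfl⟩
    exact ⟨m, n, by simp⟩
  · rintro ⟨m, n, rfl⟩
    exact ⟨_, ⟨m, n, rfl⟩, by simp⟩

theorem smul_latticeSet (c : ℝ) (u v : EuclideanSpace ℝ (Fin 2)) :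
    c • latticeSet u v = latticeSet (c • u) (c • v) :=
  image_latticeSet (c • LinearMap.id : EuclideanSpace ℝ (Fin 2) →ₗ[ℝ] _) u v

/-- Orthogonal transformations preserve the energy. -/
theorem IsRotationOf.LJenergy_eq {L L' : Set (EuclideanSpace ℝ (Fin 2))} (h : IsRotationOf L L')
    (a b α β : ℝ) : LJenergy a b α β L = LJenergy a b α β L' := by
  obtain ⟨O, rfl⟩ := h
  have hbij : Set.BijOn O (L' \ {0}) (O '' L' \ {0}) := by
    have := O.injective.injOn.bijOn_image (s := L' \ {0})
    rwa [Set.image_sdiff O.injective, Set.image_singleton, map_zero] at this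
  unfold LJenergy
  refine ((hbij.equiv O).tsum_eq _).symm.trans (tsum_congr fun p => ?_)
  change a * ‖O p‖ ^ (-α) - b * ‖O p‖ ^ (-β) = _
  rw [O.norm_map]

theorem isRotationOf_of_equilateral {u v : EuclideanSpace ℝ (Fin 2)} {c : ℝ} (hc : 0 < c)
    (hu : ‖u‖ ^ 2 = c ^ 2) (hv : ‖v‖ ^ 2 = c ^ 2) (huv : ‖u - v‖ ^ 2 = c ^ 2) :
    IsRotationOf (latticeSet u v)
      (latticeSet (c • vec2 1 0) (c • vec2 (1 / 2) (√3 / 2))) := by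
  have h3 : √3 ^ 2 = 3 := Real.sq_sqrt (by norm_num)
  have h30 : 0 < √3 := by positivity
  let e : Fin 2 → EuclideanSpace ℝ (Fin 2) := ![c⁻¹ • u, (√3 * c)⁻¹ • (2 • v - u)]
  have he : Orthonormal ℝ e := by
    simp only [norm_sq_eq_coords, PiLp.sub_apply] at hu hv huv
    constructor
    · intro i
      rw [← sq_eq_sq₀ (norm_nonneg _) zero_le_one, norm_sq_eq_coords]
      fin_cases i
      · simp [e]
        field_simp
        linarith
      · simp [e]
        field_simp
        rw [h3]
        linarith
    · intro i j hij
      fin_cases i <;> fin_cases j <;> simp [e, PiLp.inner_apply, Fin.sum_univ_two] at hij ⊢ <;>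
        field_simp <;> linarith
  let B := (basisOfOrthonormalOfCardEqFinrank he (by simp)).toOrthonormalBasis (by simpa using he)
  have hB : ∀ x y : ℝ, B.repr.symm (vec2 x y) = x • e 0 + y • e 1 := by
    intro x y
    rw [← B.sum_repr_symm, Fin.sum_univ_two]
    simp [B, vec2]
  refine ⟨B.repr.symm, ?_⟩
  rw [image_latticeSet, map_smul, map_smul, hB, hB]
  congr 1
  · simp [e, smul_smul, hc.ne']
  · simp only [e, Matrix.cons_val_zero, Matrix.cons_val_one]
    match_scalars <;> field_simp; norm_num

theorem vec2_triangle {c : ℝ} (hc : 0 < c) :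
    det2 (c • vec2 1 0) (c • vec2 (1 / 2) (√3 / 2)) ≠ 0 ∧ ‖c • vec2 1 0‖ ^ 2 = c ^ 2 ∧
      ‖c • vec2 (1 / 2) (√3 / 2)‖ ^ 2 = c ^ 2 ∧
      ‖c • vec2 1 0 - c • vec2 (1 / 2) (√3 / 2)‖ ^ 2 = c ^ 2 := by
  have h3 : √3 ^ 2 = 3 := Real.sq_sqrt (by norm_num)
  have h30 : 0 < √3 := by positivity
  simp only [norm_sq_eq_coords, PiLp.sub_apply, PiLp.smul_apply, vec2, det2]
  refine ⟨?_, ?_, ?_, ?_⟩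
  · simp [hc.ne']
  · simp
  · simp
    ring_nf
    rw [h3]
    ring
  · simp
    ring_nf
    rw [h3]
    ring

theorem lj_le_of_ratio {a b x y x₁ y₁ : ℝ} (ha : 0 < a) (hx : 0 < x) (hy : 0 < y) (hx₁ : 0 < x₁)
    (hy₁ : 0 < y₁) {k : ℕ} (hk : 4 ≤ k) (hcrit : a * k * x₁ = 3 * b * y₁)
    (hr : y ^ k * x₁ ^ 3 ≤ x ^ 3 * y₁ ^ k) :
    a * x₁ - b * y₁ ≤ a * x - b * y ∧
      (a * x - b * y = a * x₁ - b * y₁ → x = x₁ ∧ y = y₁) := by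
  obtain ⟨p, hp⟩ : ∃ p, p = x / x₁ := ⟨_, rfl⟩
  obtain ⟨r, hr'⟩ : ∃ r, r = y / y₁ := ⟨_, rfl⟩
  have hxp : x = p * x₁ := by rw [hp]; field_simp
  have hyr : y = r * y₁ := by rw [hr']; field_simp
  have hp0 : 0 < p := by rw [hp]; positivity
  have hr0 : 0 < r := by rw [hr']; positivity
  have hpr : r ^ k ≤ p ^ 3 := by
    rw [hxp, hyr, mul_pow, mul_pow] at hr
    have : 0 < x₁ ^ 3 * y₁ ^ k := by positivity
    exact le_of_mul_le_mul_right (by linarith) this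
  have hk' : (4 : ℝ) ≤ k := by exact_mod_cast hk
  have hpow : r ^ ((k : ℝ) / 3) ≤ p := by
    have h := Real.rpow_le_rpow (by positivity) hpr (show (0 : ℝ) ≤ 1 / 3 by norm_num)
    rw [← Real.rpow_natCast, ← Real.rpow_natCast, ← Real.rpow_mul hr0.le,
      ← Real.rpow_mul hp0.le] at h
    norm_num at h
    rwa [div_eq_mul_inv, ← one_div]
  have hdiff : a * x - b * y - (a * x₁ - b * y₁) = a * x₁ * (p - (1 + k / 3 * (r - 1))) := by
    rw [hxp, hyr]
    linear_combination (r - 1) / 3 * hcrit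
  have hax : 0 < a * x₁ := by positivity
  have hbern := one_add_mul_self_le_rpow_one_add (s := r - 1) (p := (k : ℝ) / 3) (by linarith)
    (by linarith)
  rw [add_sub_cancel] at hbern
  refine ⟨?_, fun heq => ?_⟩
  · have := mul_nonneg hax.le (show 0 ≤ p - (1 + k / 3 * (r - 1)) by linarith)
    linarith
  · have h0 : p - (1 + k / 3 * (r - 1)) = 0 := by
      have : a * x₁ * (p - (1 + k / 3 * (r - 1))) = 0 := by linarith
      exact (mul_eq_zero.1 this).resolve_left hax.ne'
    have hr1 : r = 1 := by
      by_contra hne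
      have hs := one_add_mul_self_lt_rpow_one_add (s := r - 1) (p := (k : ℝ) / 3) (by linarith)
        (sub_ne_zero.2 hne) (by linarith)
      rw [add_sub_cancel] at hs
      linarith
    have hp1 : p = 1 := by
      rw [hr1] at h0
      linarith
    rw [hxp, hyr, hp1, hr1]
    simp

theorem LJ_minimality_of_even {k : ℕ} (hk : 7 ≤ k) (hk' : k ≤ 12) {a b : ℝ} (ha : 0 < a)
    {c : ℝ} (hc : 0 < c)
    (hcrit : a * k * formSum k (c ^ 2) (c ^ 2) (c ^ 2) =
      3 * b * formSum 3 (c ^ 2) (c ^ 2) (c ^ 2))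
    {L : Set (EuclideanSpace ℝ (Fin 2))} (hL : IsLattice2 L) {T : Set (EuclideanSpace ℝ (Fin 2))}
    (hT : T = latticeSet (c • vec2 1 0) (c • vec2 (1 / 2) (√3 / 2))) :
    LJenergy a b ((2 * k : ℕ) : ℝ) ((2 * 3 : ℕ) : ℝ) T ≤
        LJenergy a b ((2 * k : ℕ) : ℝ) ((2 * 3 : ℕ) : ℝ) L ∧
      (LJenergy a b ((2 * k : ℕ) : ℝ) ((2 * 3 : ℕ) : ℝ) L =
          LJenergy a b ((2 * k : ℕ) : ℝ) ((2 * 3 : ℕ) : ℝ) T ↔ IsRotationOf L T) := by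
  subst hT
  obtain ⟨u, v, hd, rfl, h⟩ := hL.exists_nonObtuse
  obtain ⟨hd₁, hu₁, hv₁, huv₁⟩ := vec2_triangle hc
  have hc2 : 0 < c ^ 2 := by positivity
  have h₁ : NonObtuse (c ^ 2) (c ^ 2) (c ^ 2) := by constructor <;> linarith
  have hE := LJenergy_latticeSet a b hd h (k := k) (l := 3) (by omega) (by norm_num)
  have hE₁ := LJenergy_latticeSet a b hd₁ (by rwa [hu₁, hv₁, huv₁]) (k := k) (l := 3) (by omega)
    (by norm_num)
  rw [hu₁, hv₁, huv₁] at hE₁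
  generalize hA : ‖u‖ ^ 2 = A at *
  generalize hB : ‖v‖ ^ 2 = B at *
  generalize hC : ‖u - v‖ ^ 2 = C at *
  have hscale : ∀ m, formSum m (c ^ 2) (c ^ 2) (c ^ 2) = ((c ^ 2) ^ m)⁻¹ * formSum m 1 1 1 := by
    intro m
    simpa using formSum_smul m (c ^ 2) 1 1 1
  have hstrict : ¬(A = B ∧ B = C) →
      formSum 3 A B C ^ k * formSum k (c ^ 2) (c ^ 2) (c ^ 2) ^ 3 <
        formSum k A B C ^ 3 * formSum 3 (c ^ 2) (c ^ 2) (c ^ 2) ^ k := by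
    intro hne
    have := formSum_ratio_lt h hne hk hk'
    have hq : 0 < (((c ^ 2) ^ (k * 3)))⁻¹ := by positivity
    have e1 : formSum k (c ^ 2) (c ^ 2) (c ^ 2) ^ 3 =
        ((c ^ 2) ^ (k * 3))⁻¹ * formSum k 1 1 1 ^ 3 := by
      rw [hscale, mul_pow, inv_pow, ← pow_mul]
    have e2 : formSum 3 (c ^ 2) (c ^ 2) (c ^ 2) ^ k =
        ((c ^ 2) ^ (k * 3))⁻¹ * formSum 3 1 1 1 ^ k := by
      rw [hscale, mul_pow, inv_pow, ← pow_mul, mul_comm 3 k]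
    rw [e1, e2]
    nlinarith
  have hle : formSum 3 A B C ^ k * formSum k (c ^ 2) (c ^ 2) (c ^ 2) ^ 3 ≤
        formSum k A B C ^ 3 * formSum 3 (c ^ 2) (c ^ 2) (c ^ 2) ^ k := by
    by_cases hne : A = B ∧ B = C
    · obtain ⟨rfl, rfl⟩ := hne
      have hs : ∀ m, formSum m A A A = (A ^ m)⁻¹ * formSum m 1 1 1 := by
        intro m
        simpa using formSum_smul m A 1 1 1
      refine le_of_eq ?_
      rw [hs, hs, hscale, hscale]
      simp only [mul_pow, inv_pow, ← pow_mul, mul_comm 3 k]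
      ring
    · exact (hstrict hne).le
  obtain ⟨hmin, heq⟩ := lj_le_of_ratio ha (formSum_pos h (k := k) (by omega))
    (formSum_pos h (k := 3) (by norm_num)) (formSum_pos h₁ (k := k) (by omega))
    (formSum_pos h₁ (k := 3) (by norm_num)) (by omega) hcrit hle
  refine ⟨by rw [hE, hE₁]; linarith, fun hEE => ?_, fun hrot => hrot.LJenergy_eq _ _ _ _⟩
  rw [hE, hE₁] at hEE
  obtain ⟨hx, hy⟩ := heq (by linarith)
  have hABC : A = B ∧ B = C := by
    by_contra hne
    have := hstrict hne
    rw [hx, hy, mul_comm] at this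
    exact lt_irrefl _ this
  obtain ⟨rfl, rfl⟩ := hABC
  have hA0 := h.posA
  have hAc : A = c ^ 2 := by
    have hs : formSum 3 A A A = (A ^ 3)⁻¹ * formSum 3 1 1 1 := by
      simpa using formSum_smul 3 A 1 1 1
    rw [hs, hscale] at hy
    have := mul_right_cancel₀ (formSum_pos NonObtuse.one (k := 3) (by norm_num)).ne' hy
    exact (pow_left_inj₀ hA0.le hc2.le (by norm_num)).1 (inv_injective this)
  exact isRotationOf_of_equilateral hc (hA.trans hAc) (hB.trans hAc) (hC.trans hAc)

theorem smul_triangularLattice (t : ℝ) :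
    t • triangularLattice = latticeSet ((t * √(2 / √3)) • vec2 1 0)
      ((t * √(2 / √3)) • vec2 (1 / 2) (√3 / 2)) := by
  rw [triangularLattice, smul_latticeSet, smul_smul, smul_smul]

theorem epsteinZeta_triangularLattice {k : ℕ} (hk : 2 ≤ k) :
    epsteinZeta triangularLattice ((2 * k : ℕ) : ℝ) =
      2 * ((√(2 / √3) ^ 2) ^ k)⁻¹ * formSum k 1 1 1 := by
  have hs : 0 < √(2 / √3) := by positivity
  obtain ⟨hd, hu, hv, huv⟩ := vec2_triangle hs
  have h : NonObtuse (√(2 / √3) ^ 2) (√(2 / √3) ^ 2) (√(2 / √3) ^ 2) := by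
    simpa using NonObtuse.one.smul (c := √(2 / √3) ^ 2) (by positivity)
  rw [triangularLattice, epsteinZeta_latticeSet hd (by rwa [hu, hv, huv]) hk, hu, hv, huv,
    mul_assoc]
  simpa using formSum_smul k (√(2 / √3) ^ 2) 1 1 1

/-- The optimality condition satisfied by the triangular lattice of the critical co-volume. -/
theorem critical_covolume {k : ℕ} (hk : 4 ≤ k) {a b V : ℝ} (ha : 0 < a) (hb : 0 < b)
    (hV : V = (a * ((2 * k : ℕ) : ℝ) * epsteinZeta triangularLattice ((2 * k : ℕ) : ℝ) /
      (b * ((2 * 3 : ℕ) : ℝ) * epsteinZeta triangularLattice ((2 * 3 : ℕ) : ℝ))) ^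
        (2 / (((2 * k : ℕ) : ℝ) - ((2 * 3 : ℕ) : ℝ)))) :
    0 < V ∧ a * k * formSum k ((√V * √(2 / √3)) ^ 2) ((√V * √(2 / √3)) ^ 2)
        ((√V * √(2 / √3)) ^ 2) =
      3 * b * formSum 3 ((√V * √(2 / √3)) ^ 2) ((√V * √(2 / √3)) ^ 2)
        ((√V * √(2 / √3)) ^ 2) := by
  rw [epsteinZeta_triangularLattice (by omega), epsteinZeta_triangularLattice (by norm_num)] at hV
  have hs : 0 < √(2 / √3) := by positivity
  generalize √(2 / √3) = s at *
  have hF : 0 < formSum k 1 1 1 := formSum_pos NonObtuse.one (by omega)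
  have hG : 0 < formSum 3 1 1 1 := formSum_pos NonObtuse.one (by norm_num)
  have hk0 : 0 < (k : ℝ) := by
    have : 0 < k := by omega
    exact_mod_cast this
  have hV0 : 0 < V := by
    rw [hV]
    push_cast
    positivity
  obtain ⟨j, rfl⟩ := Nat.exists_eq_add_of_le (show 3 ≤ k by omega)
  have hj : (j : ℝ) ≠ 0 := by
    have : j ≠ 0 := by omega
    exact_mod_cast this
  have hVj : V ^ j = a * ((2 * (3 + j) : ℕ) : ℝ) * (2 * ((s ^ 2) ^ (3 + j))⁻¹ *
      formSum (3 + j) 1 1 1) /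
      (b * ((2 * 3 : ℕ) : ℝ) * (2 * ((s ^ 2) ^ 3)⁻¹ * formSum 3 1 1 1)) := by
    rw [hV, ← Real.rpow_natCast, ← Real.rpow_mul (by positivity)]
    convert Real.rpow_one _ using 2
    push_cast
    rw [show (2 : ℝ) * (3 + j) - 6 = 2 * j by ring]
    field_simp
  refine ⟨hV0, ?_⟩
  have hc : (√V * s) ^ 2 = V * s ^ 2 := by rw [mul_pow, Real.sq_sqrt hV0.le]
  have hscale : ∀ m, formSum m (V * s ^ 2) (V * s ^ 2) (V * s ^ 2) =
      ((V * s ^ 2) ^ m)⁻¹ * formSum m 1 1 1 := by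
    intro m
    simpa using formSum_smul m (V * s ^ 2) 1 1 1
  rw [hc, hscale, hscale]
  rw [eq_div_iff (by positivity)] at hVj
  push_cast at hVj ⊢
  simp only [mul_pow, pow_add] at hVj ⊢
  field_simp at hVj ⊢
  linarith

/-- Global optimality of the triangular lattice for Lennard-Jones type energies with
exponents `α ∈ {14,16,18,20,22,24}`, `β = 6`: for `a, b > 0`, the triangular lattice of
co-volume `V_{A₂} = (aαζ_{A₂}(α)/(bβζ_{A₂}(β)))^{2/(α-β)}` is the unique global minimizer,
up to rotation, of `E_f` among all two-dimensional lattices. -/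
theorem LJ_other_exponents_global_minimality
    (α β : ℝ) (hα : α ∈ ({14, 16, 18, 20, 22, 24} : Set ℝ)) (hβ : β = 6)
    (a b : ℝ) (ha : 0 < a) (hb : 0 < b) (VA2 : ℝ)
    (hVA2 : VA2 = (a * α * epsteinZeta triangularLattice α /
      (b * β * epsteinZeta triangularLattice β)) ^ (2 / (α - β))) :
    ∀ L : Set (EuclideanSpace ℝ (Fin 2)), IsLattice2 L →
      LJenergy a b α β (Real.sqrt VA2 • triangularLattice) ≤ LJenergy a b α β L ∧
      (LJenergy a b α β L = LJenergy a b α β (Real.sqrt VA2 • triangularLattice) ↔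
        IsRotationOf L (Real.sqrt VA2 • triangularLattice)) := by
  intro L hL
  obtain ⟨k, hk, hk', rfl⟩ : ∃ k : ℕ, 7 ≤ k ∧ k ≤ 12 ∧ α = ((2 * k : ℕ) : ℝ) := by
    simp only [Set.mem_insert_iff, Set.mem_singleton_iff] at hα
    rcases hα with h | h | h | h | h | h
    · exact ⟨7, by norm_num, by norm_num, by rw [h]; norm_num⟩
    · exact ⟨8, by norm_num, by norm_num, by rw [h]; norm_num⟩
    · exact ⟨9, by norm_num, by norm_num, by rw [h]; norm_num⟩
    · exact ⟨10, by norm_num, by norm_num, by rw [h]; norm_num⟩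
    · exact ⟨11, by norm_num, by norm_num, by rw [h]; norm_num⟩
    · exact ⟨12, by norm_num, by norm_num, by rw [h]; norm_num⟩
  obtain rfl : β = ((2 * 3 : ℕ) : ℝ) := by rw [hβ]; norm_num
  obtain ⟨hV0, hcrit⟩ := critical_covolume (by omega) ha hb hVA2
  exact LJ_minimality_of_even hk hk' ha (by positivity) hcrit hL (smul_triangularLattice _)
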